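/- Let (X,Σ,μ) be a standard (Lebesgue) probability space and T an invertible measure-preserving transformation of X that is aperiodic, i.e. μ({x ∈ X : T^n x = x for some n ≥ 1}) = 0. Let g:[0,1]→ℝ be concave with g(0) = lim_{x→0⁺} g(x) = 0 and 0 < lim_{x→0⁺} g(x)/η(x) < ∞, where η(x) = −x log₂ x. Let φ:[0,∞) → (0,∞) be an increasing function with ∫₁^∞ φ(x)/x² dx < ∞. Then for every binary partition P = {E, X∖E} with 0 < μ(E) < 1 such that max{μ(A) : A ∈ P_n} → 0 as n → ∞, one has limsup_{n→∞} H(g, P_n)/φ(log₂ n) = ∞. -/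

import Mathlib

open MeasureTheory Filter Set

/-- The atom of the join partition `P ∨ T⁻¹P ∨ ⋯ ∨ T^{-(n-1)}P` of the binary partition
`{E, Eᶜ}` corresponding to the 01-name `s`. -/
def cyl {X : Type*} (T : X → X) (E : Set X) (n : ℕ) (s : Fin n → Bool) : Set X :=
  {x | ∀ i : Fin n, (T^[(i : ℕ)] x ∈ E ↔ s i = true)}

/-- The `g`-entropy `H(g, P_n)` of the join partition `P_n` of the binary partition
`P = {E, Eᶜ}`. -/
noncomputable def binEnt {X : Type*} [MeasurableSpace X] (μ : Measure X)
    (T : X → X) (g : ℝ → ℝ) (E : Set X) (n : ℕ) : ℝ :=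
  ∑ s : Fin n → Bool, g ((μ (cyl T E n s)).toReal)

/-- The Shannon function `η(x) = −x·log₂ x`. -/
noncomputable def shannonF : ℝ → ℝ := fun x => -(x * Real.logb 2 x)

lemma measurableSet_cyl {X : Type*} [MeasurableSpace X] {T : X → X} (hT : Measurable T)
    {E : Set X} (hE : MeasurableSet E) (n : ℕ) (s : Fin n → Bool) :
    MeasurableSet (cyl T E n s) := by
  have : cyl T E n s = ⋂ i : Fin n, {x | T^[(i : ℕ)] x ∈ E ↔ s i = true} := by
    ext x; simp [cyl]
  rw [this]
  refine MeasurableSet.iInter fun i => ?_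
  have h : MeasurableSet (T^[(i : ℕ)] ⁻¹' E) := hT.iterate i hE
  cases hs : s i
  · have h' : {x | T^[(i : ℕ)] x ∈ E ↔ false = true} = (T^[(i : ℕ)] ⁻¹' E)ᶜ := by ext; simp
    exact h' ▸ h.compl
  · have h' : {x | T^[(i : ℕ)] x ∈ E ↔ true = true} = T^[(i : ℕ)] ⁻¹' E := by ext; simp
    exact h' ▸ h

open Classical in
lemma exists_mem_cyl {X : Type*} (T : X → X) (E : Set X) (n : ℕ) (x : X) :
    ∃ s, x ∈ cyl T E n s :=
  ⟨fun i => decide (T^[(i : ℕ)] x ∈ E), fun i => by simp⟩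

lemma disjoint_cyl {X : Type*} (T : X → X) (E : Set X) (n : ℕ) {s t : Fin n → Bool}
    (hst : s ≠ t) : Disjoint (cyl T E n s) (cyl T E n t) := by
  refine Set.disjoint_left.2 fun x hs ht => hst (funext fun i => ?_)
  exact Bool.eq_iff_iff.2 ((hs i).symm.trans (ht i))

lemma sum_measureReal_cyl {X : Type*} [MeasurableSpace X] (μ : Measure X)
    [IsProbabilityMeasure μ] {T : X → X} (hT : Measurable T)
    {E : Set X} (hE : MeasurableSet E) (n : ℕ) :
    ∑ s : Fin n → Bool, μ.real (cyl T E n s) = 1 := by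
  rw [← measureReal_biUnion_finset (fun s _ t _ h => disjoint_cyl T E n h)
    (fun s _ => measurableSet_cyl hT hE n s)]
  have : (⋃ s ∈ (Finset.univ : Finset (Fin n → Bool)), cyl T E n s) = univ :=
    eq_univ_of_forall fun x => by simpa using exists_mem_cyl T E n x
  rw [this, probReal_univ]

/-- The points of a set which do not return to it within `r` steps have measure at most
`1 / (r + 1)`. -/
lemma measureReal_no_return_le {X : Type*} [MeasurableSpace X] (μ : Measure X)
    [IsProbabilityMeasure μ] {T : X → X} (hT : MeasurePreserving T μ μ)
    {A : Set X} (hA : MeasurableSet A) (r : ℕ) :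
    μ.real {x | x ∈ A ∧ ∀ p, 1 ≤ p → p ≤ r → T^[p] x ∉ A} ≤ 1 / (r + 1) := by
  set B := {x | x ∈ A ∧ ∀ p, 1 ≤ p → p ≤ r → T^[p] x ∉ A} with hB
  have hBm : MeasurableSet B := by
    have : B = A ∩ ⋂ p, ⋂ (_ : 1 ≤ p), ⋂ (_ : p ≤ r), (T^[p] ⁻¹' A)ᶜ := by
      ext x; simp [hB]
    rw [this]
    exact hA.inter (MeasurableSet.iInter fun p => MeasurableSet.iInter fun _ =>
      MeasurableSet.iInter fun _ => (hT.measurable.iterate p hA).compl)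
  have key : ∀ i j, i < j → j ≤ r → ∀ x, T^[i] x ∈ B → T^[j] x ∉ B := by
    intro i j hij hj x hi hjB
    have := hi.2 (j - i) (by omega) (by omega)
    rw [← Function.iterate_add_apply, Nat.sub_add_cancel hij.le] at this
    exact this hjB.1
  have hdisj : (↑(Finset.range (r + 1)) : Set ℕ).PairwiseDisjoint fun i => T^[i] ⁻¹' B := by
    intro i hi j hj hij
    have hi' : i < r + 1 := by simpa using hi
    have hj' : j < r + 1 := by simpa using hj
    refine Set.disjoint_left.2 fun x hx hy => ?_
    rcases lt_or_gt_of_ne hij with h | h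
    · exact key i j h (by omega) x hx hy
    · exact key j i h (by omega) x hy hx
  have hsum := measureReal_biUnion_finset (μ := μ) hdisj
    (fun i _ => hT.measurable.iterate i hBm)
  have hpre : ∀ i, μ.real (T^[i] ⁻¹' B) = μ.real B := fun i =>
    (hT.iterate i).measureReal_preimage hBm.nullMeasurableSet
  simp only [hpre, Finset.sum_const, Finset.card_range, nsmul_eq_mul] at hsum
  rw [le_div_iff₀ (by positivity), mul_comm]
  calc ((r : ℝ) + 1) * μ.real B = _ := by rw [hsum]; push_cast; rfl
    _ ≤ 1 := measureReal_le_one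

/-- If the Shannon entropy of the `n`-names is small, then most points return to their
`n`-name quickly. -/
lemma measureReal_no_period_le {X : Type*} [MeasurableSpace X] (μ : Measure X)
    [IsProbabilityMeasure μ] {T : X → X} (hT : MeasurePreserving T μ μ)
    {E : Set X} (hE : MeasurableSet E) (n r : ℕ) {q : ℝ} (hq : 1 < q) :
    μ.real {x | ¬ ∃ p, 1 ≤ p ∧ p ≤ r ∧ ∀ i < n, (T^[i] x ∈ E ↔ T^[i + p] x ∈ E)} ≤
      binEnt μ T shannonF E n / Real.logb 2 q + q / (r + 1) := by
  classical
  have hlog : 0 < Real.logb 2 q := Real.logb_pos (by norm_num) hq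
  set a : (Fin n → Bool) → ℝ := fun s => μ.real (cyl T E n s) with ha
  set B : (Fin n → Bool) → Set X := fun s =>
    {x | x ∈ cyl T E n s ∧ ∀ p, 1 ≤ p → p ≤ r → T^[p] x ∉ cyl T E n s} with hB
  have hcover : {x | ¬ ∃ p, 1 ≤ p ∧ p ≤ r ∧ ∀ i < n, (T^[i] x ∈ E ↔ T^[i + p] x ∈ E)} ⊆
      ⋃ s ∈ (Finset.univ : Finset (Fin n → Bool)), B s := by
    intro x hx
    obtain ⟨s, hs⟩ := exists_mem_cyl T E n x
    simp only [Finset.mem_univ, iUnion_true, mem_iUnion]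
    refine ⟨s, hs, fun p hp hpr hps => hx ⟨p, hp, hpr, fun i hi => ?_⟩⟩
    have h := hps ⟨i, hi⟩
    rw [← Function.iterate_add_apply] at h
    exact (hs ⟨i, hi⟩).trans h.symm
  have hterm : ∀ s, μ.real (B s) ≤ shannonF (a s) / Real.logb 2 q + q / (r + 1) * a s := by
    intro s
    have ha0 : 0 ≤ a s := measureReal_nonneg
    have ha1 : a s ≤ 1 := measureReal_le_one
    have hη : 0 ≤ shannonF (a s) := by
      have := mul_nonpos_of_nonneg_of_nonpos ha0
        (Real.logb_nonpos (b := 2) (by norm_num) ha0 ha1)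
      simpa [shannonF] using this
    rcases le_or_gt 1 (q * a s) with h | h
    · have h1 : μ.real (B s) ≤ 1 / (r + 1) :=
        measureReal_no_return_le μ hT (measurableSet_cyl hT.measurable hE n s) r
      have h2 : (1 : ℝ) / (r + 1) ≤ q / (r + 1) * a s := by
        rw [div_mul_eq_mul_div]; gcongr
      have : 0 ≤ shannonF (a s) / Real.logb 2 q := by positivity
      linarith
    · have h1 : μ.real (B s) ≤ a s := measureReal_mono fun x hx => hx.1
      have h2 : a s ≤ shannonF (a s) / Real.logb 2 q := by
        rw [le_div_iff₀ hlog]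
        rcases ha0.eq_or_lt with h0 | h0
        · simp [← h0, shannonF]
        · have : Real.logb 2 (q * a s) ≤ 0 :=
            Real.logb_nonpos (by norm_num) (by positivity) h.le
          rw [Real.logb_mul (by positivity) h0.ne'] at this
          simp only [shannonF]
          nlinarith
      have : 0 ≤ q / (r + 1) * a s := by positivity
      linarith
  calc _ ≤ μ.real (⋃ s ∈ (Finset.univ : Finset (Fin n → Bool)), B s) := measureReal_mono hcover (measure_ne_top _ _)
    _ ≤ ∑ s, μ.real (B s) := measureReal_biUnion_finset_le _ _
    _ ≤ ∑ s, (shannonF (a s) / Real.logb 2 q + q / (r + 1) * a s) :=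
      Finset.sum_le_sum fun s _ => hterm s
    _ = _ := by
      rw [Finset.sum_add_distrib, ← Finset.sum_div, ← Finset.mul_sum,
        sum_measureReal_cyl μ hT.measurable hE n, mul_one]
      rfl

/-- A period of a prefix of a word is a period of the whole word if the prefix is at least as
long as the sum of this period and some period of the whole word. -/
lemma period_extend {w : ℕ → Prop} {m n p q : ℕ} (hq0 : 1 ≤ q) (hpq : q + p ≤ n)
    (hp : ∀ i, i + p < n → (w i ↔ w (i + p))) (hq : ∀ i, i + q < m → (w i ↔ w (i + q))) :
    ∀ i, i + p < m → (w i ↔ w (i + p)) := by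
  have hred : ∀ k i, i + k * q < m → (w i ↔ w (i + k * q)) := by
    intro k
    induction k with
    | zero => simp
    | succ k ih =>
      intro i hi
      rw [Nat.succ_mul] at hi ⊢
      rw [ih i (by omega), hq (i + k * q) (by omega), add_assoc]
  intro i hi
  have hdiv : i % q + i / q * q = i := by rw [mul_comm]; exact Nat.mod_add_div i q
  have hlt : i % q < q := Nat.mod_lt _ hq0
  have h1 := hred (i / q) (i % q) (by omega)
  have h2 := hred (i / q) (i % q + p) (by omega)
  rw [show i % q + p + i / q * q = i + p by omega] at h2
  rw [hdiv] at h1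
  rw [← h1, ← h2]
  exact hp _ (by omega)

lemma periodic_of_eventually_period {w : ℕ → Prop}
    (h : ∀ᶠ j : ℕ in atTop, ∃ p, 1 ≤ p ∧ p ≤ (2 ^ 2 ^ j) ^ 2 / 2 ∧
      ∀ i < (2 ^ 2 ^ j) ^ 4, (w i ↔ w (i + p))) :
    ∃ p, 1 ≤ p ∧ ∀ i, (w i ↔ w (i + p)) := by
  obtain ⟨J, hJ⟩ := eventually_atTop.1 h
  obtain ⟨p, hp1, hp2, hp3⟩ := hJ J le_rfl
  have hmono : ∀ j k : ℕ, j ≤ k → 2 ^ 2 ^ j ≤ 2 ^ 2 ^ k := fun j k hjk =>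
    Nat.pow_le_pow_right (by norm_num) (Nat.pow_le_pow_right (by norm_num) hjk)
  have key : ∀ j, J ≤ j → ∀ i, i + p < (2 ^ 2 ^ j) ^ 4 → (w i ↔ w (i + p)) := by
    intro j hj
    induction j, hj using Nat.le_induction with
    | base => exact fun i hi => hp3 i (by omega)
    | succ j hj ih =>
      obtain ⟨q, hq1, hq2, hq3⟩ := hJ (j + 1) (by omega)
      refine period_extend hq1 ?_ ih fun i hi => hq3 i (by omega)
      have h1 : (2 ^ 2 ^ (j + 1)) ^ 2 = (2 ^ 2 ^ j) ^ 4 := by ring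
      have h2 : (2 ^ 2 ^ J) ^ 2 ≤ (2 ^ 2 ^ j) ^ 4 :=
        (Nat.pow_le_pow_left (hmono J j hj) 2).trans
          (Nat.pow_le_pow_right (by positivity) (by norm_num))
      rw [h1] at hq2
      omega
  refine ⟨p, hp1, fun i => key (max J (i + p)) (le_max_left _ _) i ?_⟩
  calc i + p < 2 ^ (i + p) := Nat.lt_two_pow_self
    _ ≤ 2 ^ 2 ^ (i + p) := Nat.pow_le_pow_right (by norm_num) Nat.lt_two_pow_self.le
    _ ≤ 2 ^ 2 ^ max J (i + p) := hmono _ _ (le_max_right _ _)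
    _ ≤ (2 ^ 2 ^ max J (i + p)) ^ 4 := Nat.le_self_pow (by norm_num) _

/-- If the atoms of the join partitions shrink, then almost no point has a periodic name. -/
lemma measure_periodic_name_eq_zero {X : Type*} [MeasurableSpace X] (μ : Measure X)
    (T : X → X) (E : Set X)
    (hmax : Tendsto (fun n => ⨆ s : Fin n → Bool, μ (cyl T E n s)) atTop (nhds 0)) :
    μ {x | ∃ p, 1 ≤ p ∧ ∀ i, (T^[i] x ∈ E ↔ T^[i + p] x ∈ E)} = 0 := by
  have hname : ∀ ω : ℕ → Bool, μ {x | ∀ i, (T^[i] x ∈ E ↔ ω i = true)} = 0 := by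
    intro ω
    refine le_antisymm (ge_of_tendsto' hmax fun n => ?_) bot_le
    have hsub : {x | ∀ i, (T^[i] x ∈ E ↔ ω i = true)} ⊆ cyl T E n fun i => ω i :=
      fun x hx i => hx i
    exact (measure_mono hsub).trans
      (le_iSup (fun s : Fin n → Bool => μ (cyl T E n s)) fun i => ω i)
  refine measure_mono_null (t := ⋃ P : (p : ℕ) × (Fin (p + 1) → Bool),
    {x | ∀ i, (T^[i] x ∈ E ↔ P.2 ⟨i % (P.1 + 1), Nat.mod_lt _ P.1.succ_pos⟩ = true)}) ?_
    (measure_iUnion_null fun P => hname _)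
  rintro x ⟨p, hp, hx⟩
  obtain ⟨s, hs⟩ := exists_mem_cyl T E (p - 1 + 1) x
  refine mem_iUnion.2 ⟨⟨p - 1, s⟩, fun i => ?_⟩
  rw [← hs]
  have hper : Function.Periodic (fun i => T^[i] x ∈ E) p := fun i => propext (hx i).symm
  have := hper.map_mod_nat i
  simp only [Nat.sub_add_cancel hp]
  exact (iff_of_eq this).symm

/-- Cauchy condensation for the convergence of `∫ φ(x) / x ^ 2`. -/
lemma summable_condensed_of_integrable {φ : ℝ → ℝ} (hφpos : ∀ x : ℝ, 0 ≤ x → 0 < φ x)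
    (hφmono : MonotoneOn φ (Set.Ici 0))
    (hφint : IntegrableOn (fun x => φ x / x ^ 2) (Set.Ioi 1)) :
    Summable fun j : ℕ => φ (4 * 2 ^ j) / 2 ^ j := by
  have hmono : Monotone fun j : ℕ => (4 : ℝ) * 2 ^ j := fun a b hab => by
    dsimp only; gcongr; norm_num
  set I : ℕ → Set ℝ := fun j => Ioc (4 * 2 ^ j) (4 * 2 ^ (j + 1)) with hI
  have hdisj : Pairwise (Function.onFun Disjoint I) := hmono.pairwise_disjoint_on_Ioc_succ
  have hsub : ∀ j, I j ⊆ Ioi 1 := fun j x hx => by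
    have : (1 : ℝ) ≤ 2 ^ j := one_le_pow₀ (by norm_num)
    have := hx.1
    simp only [mem_Ioi]; linarith
  have hsum : Summable fun j => ∫ x in I j, φ x / x ^ 2 :=
    (hasSum_integral_iUnion (fun j => measurableSet_Ioc) hdisj
      (hφint.mono_set (iUnion_subset hsub))).summable
  refine Summable.of_nonneg_of_le (fun j => ?_) (fun j => ?_) (hsum.mul_left 16)
  · exact div_nonneg (hφpos _ (by positivity)).le (by positivity)
  · have hc : ∫ x in I j, φ (4 * 2 ^ j) / (4 * 2 ^ (j + 1)) ^ 2 ≤ ∫ x in I j, φ x / x ^ 2 := by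
      refine setIntegral_mono_on (integrableOn_const (by simp [hI]))
        (hφint.mono_set (hsub j)) measurableSet_Ioc fun x hx => ?_
      have hpos : (0 : ℝ) < 4 * 2 ^ j := by positivity
      have hx0 : 0 < x := hpos.trans hx.1
      have h1 := hφmono hpos.le hx0.le hx.1.le
      have h2 := (hφpos x hx0.le).le
      have h3 := hx.2
      gcongr
    rw [setIntegral_const, Real.volume_real_Ioc_of_le (hmono j.le_succ)] at hc
    refine le_trans (le_of_eq ?_) (mul_le_mul_of_nonneg_left hc (by norm_num))
    simp only [smul_eq_mul, Nat.succ_eq_add_one, pow_succ]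
    field_simp
    ring

lemma eventually_shannonF_le {g : ℝ → ℝ} {L : ℝ} (hL : 0 < L)
    (hg : Tendsto (fun x => g x / shannonF x) (nhdsWithin 0 (Set.Ioi 0)) (nhds L)) :
    ∀ᶠ x in nhdsWithin 0 (Set.Ioi 0), shannonF x ≤ 2 / L * g x := by
  have h1 : ∀ᶠ x : ℝ in nhdsWithin 0 (Set.Ioi 0), x < 1 :=
    nhdsWithin_le_nhds (Iio_mem_nhds one_pos)
  filter_upwards [hg.eventually (lt_mem_nhds (half_lt_self hL)), h1, self_mem_nhdsWithin]
    with x hx hx1 hx0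
  have hη : 0 < shannonF x := by
    have := mul_neg_of_pos_of_neg hx0 (Real.logb_neg (b := 2) (by norm_num) hx0 hx1)
    simpa [shannonF] using this
  rw [lt_div_iff₀ hη] at hx
  rw [div_mul_eq_mul_div, le_div_iff₀ hL]
  linarith

/-- If the atoms of the join partitions shrink, then the Shannon entropy is eventually bounded
by a multiple of the `g`-entropy. -/
lemma eventually_binEnt_shannonF_le {X : Type*} [MeasurableSpace X] (μ : Measure X)
    [IsProbabilityMeasure μ] (T : X → X) (E : Set X)
    {g : ℝ → ℝ} (hg0 : g 0 = 0) {L : ℝ} (hL : 0 < L)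
    (hg : Tendsto (fun x => g x / shannonF x) (nhdsWithin 0 (Set.Ioi 0)) (nhds L))
    (hmax : Tendsto (fun n => ⨆ s : Fin n → Bool, μ (cyl T E n s)) atTop (nhds 0)) :
    ∀ᶠ n in atTop, binEnt μ T shannonF E n ≤ 2 / L * binEnt μ T g E n := by
  obtain ⟨δ, hδ, hsub⟩ := mem_nhdsGT_iff_exists_Ioo_subset.1 (eventually_shannonF_le hL hg)
  have hδ' : (0 : ENNReal) < ENNReal.ofReal δ := ENNReal.ofReal_pos.2 hδ
  filter_upwards [hmax.eventually (gt_mem_nhds hδ')] with n hn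
  unfold binEnt
  rw [Finset.mul_sum]
  refine Finset.sum_le_sum fun s _ => ?_
  have hs := (le_iSup (fun s : Fin n → Bool => μ (cyl T E n s)) s).trans_lt hn
  rcases (ENNReal.toReal_nonneg (a := μ (cyl T E n s))).eq_or_lt with h | h
  · simp [← h, hg0, shannonF]
  · exact hsub ⟨h, (ENNReal.lt_ofReal_iff_toReal_lt (measure_ne_top _ _)).1 hs⟩

lemma measure_periodic_name_compl_eq_zero {X : Type*} [MeasurableSpace X] (μ : Measure X)
    [IsProbabilityMeasure μ] {T : X → X} (hT : MeasurePreserving T μ μ)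
    {E : Set X} (hE : MeasurableSet E) {b : ℕ → ℝ} (hb : Summable fun j => b j / 2 ^ j)
    (hbound : ∀ᶠ j : ℕ in atTop, binEnt μ T shannonF E ((2 ^ 2 ^ j) ^ 4) ≤ b j) :
    μ {x | ¬ ∃ p, 1 ≤ p ∧ ∀ i, (T^[i] x ∈ E ↔ T^[i + p] x ∈ E)} = 0 := by
  set bad : ℕ → X → Prop := fun j x => ¬ ∃ p, 1 ≤ p ∧ p ≤ (2 ^ 2 ^ j) ^ 2 / 2 ∧
    ∀ i < (2 ^ 2 ^ j) ^ 4, (T^[i] x ∈ E ↔ T^[i + p] x ∈ E) with hbad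
  have hle : ∀ᶠ j in atTop, ‖μ.real {x | bad j x}‖ ≤ b j / 2 ^ j + 2 * (1 / 2) ^ j := by
    filter_upwards [hbound] with j hj
    rw [Real.norm_of_nonneg measureReal_nonneg]
    set Q : ℕ := 2 ^ 2 ^ j with hQ
    have hQ1 : (1 : ℝ) < (Q : ℝ) := by
      rw [hQ]; push_cast; exact one_lt_pow₀ (by norm_num) (by positivity)
    have hQj : (2 : ℝ) ^ j ≤ Q := by
      rw [hQ]; push_cast
      exact pow_le_pow_right₀ (by norm_num) Nat.lt_two_pow_self.le
    have hlog : Real.logb 2 (Q : ℝ) = 2 ^ j := by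
      rw [hQ]; push_cast
      rw [Real.logb_pow, Real.logb_self_eq_one (by norm_num)]; push_cast; ring
    refine (measureReal_no_period_le μ hT hE (Q ^ 4) (Q ^ 2 / 2) hQ1).trans ?_
    rw [hlog]
    have hr : (Q : ℝ) ^ 2 ≤ 2 * (((Q ^ 2 / 2 : ℕ) : ℝ) + 1) := by
      have : Q ^ 2 ≤ 2 * (Q ^ 2 / 2 + 1) := by omega
      exact_mod_cast this
    have h2 : (Q : ℝ) / (((Q ^ 2 / 2 : ℕ) : ℝ) + 1) ≤ 2 * (1 / 2) ^ j := by
      rw [one_div, inv_pow, ← div_eq_mul_inv, div_le_div_iff₀ (by positivity) (by positivity)]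
      nlinarith
    gcongr
  have hsum : Summable fun j => μ.real {x | bad j x} :=
    Summable.of_norm_bounded_eventually_nat
      (hb.add (summable_geometric_two.mul_left 2)) hle
  have hfin : ∑' j, μ {x | bad j x} ≠ ⊤ := by
    simpa [measureReal_def] using hsum.tsum_ofReal_ne_top
  refine measure_mono_null (fun x hx => ?_) (measure_setOfPred_frequently_eq_zero hfin)
  intro hx'
  exact hx (periodic_of_eventually_period (hx'.mono fun j hj => not_not.1 hj))

/-- For every aperiodic invertible measure-preserving transformation of a standard
probability space, every entropy function `g ∈ G₀^sh`, every increasing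
`φ : [0,∞) → (0,∞)` with `∫₁^∞ φ(x)/x² dx < ∞`, and every binary partition whose join
partitions have maximal atom measure tending to `0`,
`limsup H(g, Pₙ)/φ(log₂ n) = ∞`. -/
theorem statement3 {X : Type*} [MeasurableSpace X] [StandardBorelSpace X]
    (μ : Measure X) [IsProbabilityMeasure μ] (T : X → X)
    (hT : MeasurePreserving T μ μ)
    (hinv : ∃ S : X → X, Measurable S ∧ Function.LeftInverse S T ∧ Function.RightInverse S T)
    (haper : μ {x | ∃ n : ℕ, 1 ≤ n ∧ T^[n] x = x} = 0)
    (g : ℝ → ℝ) (hconc : ConcaveOn ℝ (Set.Icc 0 1) g) (hg0 : g 0 = 0)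
    (hg0' : Tendsto g (nhdsWithin 0 (Set.Ioi 0)) (nhds 0))
    (hsh : ∃ L : ℝ, 0 < L ∧
      Tendsto (fun x => g x / shannonF x) (nhdsWithin 0 (Set.Ioi 0)) (nhds L))
    (φ : ℝ → ℝ)
    (hφpos : ∀ x : ℝ, 0 ≤ x → 0 < φ x)
    (hφmono : MonotoneOn φ (Set.Ici 0))
    (hφint : IntegrableOn (fun x => φ x / x ^ 2) (Set.Ioi 1))
    (E : Set X) (hE : MeasurableSet E) (h0 : 0 < μ E) (h1 : μ E < 1)
    (hmax : Tendsto (fun n => ⨆ s : Fin n → Bool, μ (cyl T E n s)) atTop (nhds 0)) :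
    Filter.limsup
      (fun n : ℕ => ((binEnt μ T g E n / φ (Real.logb 2 n) : ℝ) : EReal)) atTop = ⊤ := by
  obtain ⟨L, hL, hLg⟩ := hsh
  by_contra hlim
  obtain ⟨M, hM, -⟩ := EReal.lt_iff_exists_real_btwn.1 (lt_top_iff_ne_top.2 hlim)
  have hpow : Tendsto (fun j : ℕ => (2 ^ 2 ^ j) ^ 4) atTop atTop :=
    tendsto_atTop_mono (fun j => (Nat.lt_two_pow_self.le.trans
      (Nat.pow_le_pow_right two_pos Nat.lt_two_pow_self.le)).trans
        (Nat.le_self_pow (by norm_num) _)) tendsto_id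
  have hbound : ∀ᶠ j : ℕ in atTop, binEnt μ T shannonF E ((2 ^ 2 ^ j) ^ 4) ≤
      2 / L * (M * φ (4 * 2 ^ j)) := by
    filter_upwards [hpow.eventually (eventually_lt_of_limsup_lt hM),
      hpow.eventually (eventually_binEnt_shannonF_le μ T E hg0 hL hLg hmax)] with j h2 h3
    have hlog : Real.logb 2 (((2 ^ 2 ^ j) ^ 4 : ℕ) : ℝ) = 4 * 2 ^ j := by
      push_cast
      rw [Real.logb_pow, Real.logb_pow, Real.logb_self_eq_one (by norm_num)]
      push_cast; ring
    rw [hlog, EReal.coe_lt_coe_iff, div_lt_iff₀ (hφpos _ (by positivity))] at h2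
    exact h3.trans (by gcongr)
  have hsum : Summable fun j : ℕ => 2 / L * (M * φ (4 * 2 ^ j)) / 2 ^ j := by
    refine ((summable_condensed_of_integrable hφpos hφmono hφint).mul_left (2 / L * M)).congr
      fun j => ?_
    ring
  have hnull := measure_union_null (measure_periodic_name_eq_zero μ T E hmax)
    (measure_periodic_name_compl_eq_zero μ hT hE hsum hbound)
  have huniv : {x | ∃ p, 1 ≤ p ∧ ∀ i, (T^[i] x ∈ E ↔ T^[i + p] x ∈ E)} ∪
      {x | ¬ ∃ p, 1 ≤ p ∧ ∀ i, (T^[i] x ∈ E ↔ T^[i + p] x ∈ E)} = univ :=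
    union_compl_self _
  rw [huniv, measure_univ] at hnull
  exact one_ne_zero hnull
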